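/- Let γ₁, …, γ_p be finitely many elements of the free abelian group ℤ × ℤ of rank 2. Then there exists an integer n > 0 and a surjective additive group homomorphism φₙ : ℤ × ℤ → ℤ/nℤ such that for every i ∈ {1, …, p}, the element φₙ(γᵢ) does not generate ℤ/nℤ, i.e., the cyclic subgroup of multiples of φₙ(γᵢ) is a proper subgroup of ℤ/nℤ. -/

import Mathlib

/-- Given finitely many elements `γ₁, …, γ_p` of `ℤ × ℤ`, there is an
integer `n > 0` and a surjective additive homomorphism `φₙ : ℤ × ℤ → ℤ/nℤ` such that
no `φₙ(γᵢ)` generates `ℤ/nℤ`. -/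
theorem exists_epimorphism_images_not_generating
    (p : ℕ) (γ : Fin p → ℤ × ℤ) :
    ∃ n : ℕ, 0 < n ∧ ∃ φ : ℤ × ℤ →+ ZMod n, Function.Surjective φ ∧
      ∀ i : Fin p, AddSubgroup.zmultiples (φ (γ i)) ≠ ⊤ := by
  obtain ⟨K, hK2, hK⟩ : ∃ K : ℤ, 2 ≤ K ∧ ∀ i, |(γ i).1| + 2 ≤ K := by
    refine ⟨∑ i, |(γ i).1| + 2, ?_, fun i => ?_⟩
    · have : 0 ≤ ∑ i, |(γ i).1| := Finset.sum_nonneg fun i _ => abs_nonneg _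
      linarith
    · have := Finset.single_le_sum (f := fun i => |(γ i).1|)
        (fun i _ => abs_nonneg _) (Finset.mem_univ i)
      simpa using this
  let f : ℤ × ℤ →+ ℤ :=
    { toFun := fun x => K * x.1 + (K ^ 2 + 1) * x.2
      map_zero' := by simp
      map_add' := fun x y => by simp; ring }
  have hf : ∀ x, f x = K * x.1 + (K ^ 2 + 1) * x.2 := fun x => rfl
  have hne : ∀ i, (f (γ i)).natAbs ≠ 1 := by
    intro i h
    have h1 := hK i
    rw [hf] at h
    generalize (γ i).1 = a at *
    generalize (γ i).2 = b at *
    have ha := abs_le.mp (show |a| ≤ K - 2 by linarith)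
    obtain ⟨ha1, ha2⟩ := ha
    have h2 : K * a + (K ^ 2 + 1) * b = 1 ∨ K * a + (K ^ 2 + 1) * b = -1 := Int.natAbs_eq_iff.mp h
    have e1 : K * a ≤ K * (K - 2) := by gcongr
    have e2 : K * (-(K - 2)) ≤ K * a := by gcongr
    rcases lt_trichotomy b 0 with hb | hb | hb
    · have : (K ^ 2 + 1) * b ≤ (K ^ 2 + 1) * (-1) := by gcongr; omega
      rcases h2 with h2 | h2 <;> nlinarith
    · subst hb
      have hd : K ∣ 1 := by
        rcases h2 with h2 | h2
        · exact ⟨a, by linarith⟩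
        · exact ⟨-a, by linarith⟩
      have := Int.le_of_dvd one_pos hd
      linarith
    · have : (K ^ 2 + 1) * 1 ≤ (K ^ 2 + 1) * b := by gcongr; omega
      rcases h2 with h2 | h2 <;> nlinarith
  let g : Fin p → ℕ := fun i => if f (γ i) = 0 then 1 else (f (γ i)).natAbs
  let n : ℕ := 2 * ∏ i, g i
  have hn : 0 < n := by
    refine Nat.mul_pos two_pos (Finset.prod_pos fun i _ => ?_)
    by_cases h : f (γ i) = 0
    · simp [g, h]
    · simp [g, h]
  refine ⟨n, hn, (Int.castAddHom (ZMod n)).comp f, ?_, ?_⟩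
  · intro z
    obtain ⟨m, rfl⟩ := ZMod.intCast_surjective z
    refine ⟨(-K * m, m), ?_⟩
    simp only [AddMonoidHom.comp_apply, hf, Int.coe_castAddHom]
    congr 1
    ring
  · intro i htop
    have h1 : (1 : ZMod n) ∈ AddSubgroup.zmultiples
        (((Int.castAddHom (ZMod n)).comp f) (γ i)) := by rw [htop]; trivial
    obtain ⟨k, hk⟩ := AddSubgroup.mem_zmultiples_iff.mp h1
    simp only [AddMonoidHom.comp_apply, Int.coe_castAddHom, zsmul_eq_mul] at hk
    have hk' : ((k * f (γ i) : ℤ) : ZMod n) = ((1 : ℤ) : ZMod n) := by push_cast; exact hk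
    have hd := (ZMod.intCast_eq_intCast_iff_dvd_sub _ _ _).mp hk'
    by_cases h : f (γ i) = 0
    · have h2 : (2 : ℤ) ∣ (n : ℤ) := by
        exact_mod_cast (Dvd.intro _ rfl : 2 ∣ n)
      have := h2.trans hd
      rw [h] at this
      norm_num at this
    · have h2 : g i ∣ n := (Finset.dvd_prod_of_mem g (Finset.mem_univ i)).trans (Dvd.intro_left _ rfl)
      have h3 : f (γ i) ∣ (n : ℤ) := by
        have : (f (γ i)).natAbs ∣ n := by simpa [g, h] using h2
        exact Int.natAbs_dvd.mp (Int.natCast_dvd_natCast.mpr this)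
      have h4 : f (γ i) ∣ 1 := by
        have := (h3.trans hd).add (Dvd.intro_left k rfl : f (γ i) ∣ k * f (γ i))
        simpa using this
      exact hne i (Int.natAbs_of_isUnit (isUnit_of_dvd_one h4))
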